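/- arXiv:2603.09299 — 2 statements merged into one kernel-verified Lean document; each statement's English description precedes it below -/
import Mathlib

section
/- Suppose CG < Cp, h1/μ1 ≥ h2/μ2 and μ2 ≥ μ1. Then for every decision state (i,j,k,l) ∈ X_D with l < CG one has D(i,j,k,l) = v(i,j-1,k+1,l) − v(i,j-1,k,l+1) ≥ 0. Moreover, if in addition h1/μ1 > h2/μ2 strictly, then D(i,j,k,l) > 0 strictly. -/
/-- Total service rate `d(j,k,l) = j·μ0 + k·μ1 + min(l,CG)·μ2`. -/
noncomputable def dRate (μ0 μ1 μ2 : ℝ) (CG j k l : ℕ) : ℝ :=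
  (j : ℝ) * μ0 + (k : ℝ) * μ1 + ((min l CG : ℕ) : ℝ) * μ2

/-- The value function `v`, defined by well-founded recursion on `2(i+j)+k+l`.
For nonzero states of the state space it satisfies
`d(j,k,l) · v i j k l = holding costs + transition terms`
(terms with zero coefficient are guarded by `if` and contribute `0`). -/
noncomputable def v (μ0 μ1 μ2 h0 h1 h2 : ℝ) (CG : ℕ) : ℕ → ℕ → ℕ → ℕ → ℝ
  | 0, 0, 0, 0 => 0
  | 0, j, k, l =>
    ((j : ℝ) * h0 + (k : ℝ) * h1 + (l : ℝ) * h2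
      + (if _ : 1 ≤ j then
          (j : ℝ) * μ0 *
            min (v μ0 μ1 μ2 h0 h1 h2 CG 0 (j - 1) (k + 1) l)
                (v μ0 μ1 μ2 h0 h1 h2 CG 0 (j - 1) k (l + 1))
        else 0)
      + (if _ : 1 ≤ k then (k : ℝ) * μ1 * v μ0 μ1 μ2 h0 h1 h2 CG 0 j (k - 1) l else 0)
      + (if _ : 1 ≤ l then
          ((min l CG : ℕ) : ℝ) * μ2 * v μ0 μ1 μ2 h0 h1 h2 CG 0 j k (l - 1)
        else 0))
    / dRate μ0 μ1 μ2 CG j k l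
  | i + 1, j, k, l =>
    (((i : ℝ) + 1 + (j : ℝ)) * h0 + (k : ℝ) * h1 + (l : ℝ) * h2
      + (if _ : 1 ≤ j then
          (j : ℝ) * μ0 *
            min (v μ0 μ1 μ2 h0 h1 h2 CG (i + 1) (j - 1) (k + 1) l)
                (v μ0 μ1 μ2 h0 h1 h2 CG (i + 1) (j - 1) k (l + 1))
        else 0)
      + (if _ : 1 ≤ k then (k : ℝ) * μ1 * v μ0 μ1 μ2 h0 h1 h2 CG i (j + 1) (k - 1) l else 0)
      + (if _ : 1 ≤ l then
          ((min l CG : ℕ) : ℝ) * μ2 * v μ0 μ1 μ2 h0 h1 h2 CG i (j + 1) k (l - 1)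
        else 0))
    / dRate μ0 μ1 μ2 CG j k l
termination_by i j k l => 2 * (i + j) + k + l
decreasing_by all_goals omega

/-- Membership in the state space `X`. -/
def memX (Cp : ℕ) (i j k l : ℕ) : Prop :=
  (i = 0 ∧ j + k + l < Cp) ∨ j + k + l = Cp

/-- State value after a departure: the next waiting job (if any) enters phase 0. -/
def nx (f : ℕ → ℕ → ℕ → ℕ → ℝ) (i j k l : ℕ) : ℝ :=
  match i with
  | 0 => f 0 j k l
  | i + 1 => f i (j + 1) k l

/-- The optimality equation. -/
def IsRec (μ0 μ1 μ2 h0 h1 h2 : ℝ) (CG : ℕ) (f : ℕ → ℕ → ℕ → ℕ → ℝ) : Prop :=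
  ∀ i j k l : ℕ, (i = 0 ∨ 1 ≤ j + k + l) →
    ((j : ℝ) * μ0 + (k : ℝ) * μ1 + ((min l CG : ℕ) : ℝ) * μ2) * f i j k l
      = ((i : ℝ) + j) * h0 + (k : ℝ) * h1 + (l : ℝ) * h2
        + (j : ℝ) * μ0 * min (f i (j - 1) (k + 1) l) (f i (j - 1) k (l + 1))
        + (k : ℝ) * μ1 * nx f i j (k - 1) l
        + ((min l CG : ℕ) : ℝ) * μ2 * nx f i j k (l - 1)

lemma dRate_pos {μ0 μ1 μ2 : ℝ} {CG : ℕ} (hCG : 0 < CG)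
    (hμ0 : 0 < μ0) (hμ1 : 0 < μ1) (hμ2 : 0 < μ2) (j k l : ℕ) (h : 1 ≤ j + k + l) :
    0 < (j : ℝ) * μ0 + (k : ℝ) * μ1 + ((min l CG : ℕ) : ℝ) * μ2 := by
  have hj : 0 ≤ (j : ℝ) * μ0 := by positivity
  have hk : 0 ≤ (k : ℝ) * μ1 := by positivity
  have hl : 0 ≤ ((min l CG : ℕ) : ℝ) * μ2 := by positivity
  rcases Nat.eq_zero_or_pos j with rfl | hj'
  · rcases Nat.eq_zero_or_pos k with rfl | hk'
    · have : 0 < min l CG := by omega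
      have : 0 < ((min l CG : ℕ) : ℝ) * μ2 := by positivity
      linarith
    · have : 0 < (k : ℝ) * μ1 := by positivity
      linarith
  · have : 0 < (j : ℝ) * μ0 := by positivity
    linarith

lemma v_isRec {μ0 μ1 μ2 : ℝ} (h0 h1 h2 : ℝ) {CG : ℕ} (hCG : 0 < CG)
    (hμ0 : 0 < μ0) (hμ1 : 0 < μ1) (hμ2 : 0 < μ2) :
    IsRec μ0 μ1 μ2 h0 h1 h2 CG (v μ0 μ1 μ2 h0 h1 h2 CG) := by
  intro i j k l hs
  by_cases hz : 1 ≤ j + k + l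
  · have hd := dRate_pos (CG := CG) hCG hμ0 hμ1 hμ2 j k l hz
    have hJ : ∀ x : ℝ, (if _ : 1 ≤ j then (j : ℝ) * μ0 * x else 0) = (j : ℝ) * μ0 * x := by
      intro x
      split_ifs with h
      · rfl
      · have : j = 0 := by omega
        simp [this]
    have hK : ∀ x : ℝ, (if _ : 1 ≤ k then (k : ℝ) * μ1 * x else 0) = (k : ℝ) * μ1 * x := by
      intro x
      split_ifs with h
      · rfl
      · have : k = 0 := by omega
        simp [this]
    have hL : ∀ x : ℝ, (if _ : 1 ≤ l then ((min l CG : ℕ) : ℝ) * μ2 * x else 0)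
        = ((min l CG : ℕ) : ℝ) * μ2 * x := by
      intro x
      split_ifs with h
      · rfl
      · have : l = 0 := by omega
        simp [this]
    cases i with
    | zero =>
      conv_lhs => rw [v.eq_2 _ _ _ _ _ _ _ _ _ _ (by omega)]
      rw [hJ, hK, hL, dRate, mul_div_cancel₀ _ hd.ne']
      simp [nx]
    | succ i =>
      conv_lhs => rw [v.eq_3]
      rw [hJ, hK, hL, dRate, mul_div_cancel₀ _ hd.ne']
      simp [nx]
  · obtain rfl : i = 0 := by omega
    obtain rfl : j = 0 := by omega
    obtain rfl : k = 0 := by omega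
    obtain rfl : l = 0 := by omega
    simp

lemma term_bound (n : ℕ) {r c x y : ℝ} (hr : 0 < r) (h : 1 ≤ n → c ≤ x - y) :
    (n : ℝ) * r * c ≤ (n : ℝ) * r * x - (n : ℝ) * r * y := by
  rcases Nat.eq_zero_or_pos n with rfl | hn
  · simp
  · have := mul_le_mul_of_nonneg_left (h hn) (show 0 ≤ (n : ℝ) * r by positivity)
    linarith

lemma min_bound {c x y x' y' : ℝ} (h : c ≤ x - x') (h' : c ≤ y - y') :
    c ≤ min x y - min x' y' := by
  rcases min_cases x y with ⟨e, _⟩ | ⟨e, _⟩ <;> rw [e]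
  · linarith [min_le_left x' y']
  · linarith [min_le_right x' y']

section bounds
variable {μ0 μ1 μ2 h0 h1 h2 c : ℝ} {CG : ℕ} {f : ℕ → ℕ → ℕ → ℕ → ℝ}

/-- An extra phase 1 job, with an empty queue. -/
lemma bound_E (hf : IsRec μ0 μ1 μ2 h0 h1 h2 CG f)
    (hμ0 : 0 < μ0) (hμ1 : 0 < μ1) (hμ2 : 0 < μ2) (hc1 : μ1 * c ≤ h1) (N : ℕ) :
    ∀ a k l : ℕ, 2 * a + k + l < N → c ≤ f 0 a (k + 1) l - f 0 a k l := by
  induction N with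
  | zero => intro a k l h; omega
  | succ N ih =>
    intro a k l hN
    have e1 := hf 0 a (k + 1) l (Or.inl rfl)
    have e2 := hf 0 a k l (Or.inl rfl)
    simp only [nx, Nat.add_sub_cancel] at e1 e2
    have tj := term_bound a hμ0 (c := c)
      (x := min (f 0 (a - 1) (k + 1 + 1) l) (f 0 (a - 1) (k + 1) (l + 1)))
      (y := min (f 0 (a - 1) (k + 1) l) (f 0 (a - 1) k (l + 1)))
      (fun h => min_bound (ih _ _ _ (by omega)) (ih _ _ _ (by omega)))
    have tk := term_bound k hμ1 (c := c) (x := f 0 a k l) (y := f 0 a (k - 1) l)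
      (fun h => by
        have := ih a (k - 1) l (by omega)
        rwa [Nat.sub_add_cancel h] at this)
    have tl := term_bound (min l CG) hμ2 (c := c) (x := f 0 a (k + 1) (l - 1))
      (y := f 0 a k (l - 1)) (fun h => ih _ _ _ (by omega))
    have hR : 0 < (a : ℝ) * μ0 + (k : ℝ) * μ1 + ((min l CG : ℕ) : ℝ) * μ2 + μ1 := by positivity
    refine le_of_mul_le_mul_left ?_ hR
    push_cast at e1 e2 tl ⊢
    linarith

/-- An extra phase 2 job, with an empty queue. -/
lemma bound_L (hf : IsRec μ0 μ1 μ2 h0 h1 h2 CG f) (hCG : 0 < CG)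
    (hμ0 : 0 < μ0) (hμ1 : 0 < μ1) (hμ2 : 0 < μ2) (hh2 : 0 < h2) (hc2 : μ2 * c ≤ h2) (N : ℕ) :
    ∀ a k l : ℕ, 2 * a + k + l < N → c ≤ f 0 a k (l + 1) - f 0 a k l := by
  induction N with
  | zero => intro a k l h; omega
  | succ N ih =>
    intro a k l hN
    have e1 := hf 0 a k (l + 1) (Or.inl rfl)
    have e2 := hf 0 a k l (Or.inl rfl)
    simp only [nx, Nat.add_sub_cancel] at e1 e2
    have tj := term_bound a hμ0 (c := c)
      (x := min (f 0 (a - 1) (k + 1) (l + 1)) (f 0 (a - 1) k (l + 1 + 1)))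
      (y := min (f 0 (a - 1) (k + 1) l) (f 0 (a - 1) k (l + 1)))
      (fun h => min_bound (ih _ _ _ (by omega)) (ih _ _ _ (by omega)))
    have tk := term_bound k hμ1 (c := c) (x := f 0 a (k - 1) (l + 1)) (y := f 0 a (k - 1) l)
      (fun h => ih _ _ _ (by omega))
    have tl := term_bound (min l CG) hμ2 (c := c) (x := f 0 a k l)
      (y := f 0 a k (l - 1)) (fun h => by
        have h1 : 1 ≤ l := by omega
        have := ih a k (l - 1) (by omega)
        rwa [Nat.sub_add_cancel h1] at this)
    rcases lt_or_ge l CG with hl | hl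
    · have m1 : min (l + 1) CG = l + 1 := by omega
      have m2 : min l CG = l := by omega
      rw [m1] at e1
      rw [m2] at e2 tl
      have hR : 0 < (a : ℝ) * μ0 + (k : ℝ) * μ1 + (l : ℝ) * μ2 + μ2 := by positivity
      refine le_of_mul_le_mul_left ?_ hR
      push_cast at e1 e2 tl ⊢
      linarith
    · have m1 : min (l + 1) CG = CG := by omega
      have m2 : min l CG = CG := by omega
      rw [m1] at e1
      rw [m2] at e2 tl
      have hR : 0 < (a : ℝ) * μ0 + (k : ℝ) * μ1 + (CG : ℝ) * μ2 := by positivity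
      refine le_of_mul_le_mul_left ?_ hR
      push_cast at e1 e2 tl ⊢
      linarith

/-- An extra phase 0 job, with an empty queue. -/
lemma bound_H (hf : IsRec μ0 μ1 μ2 h0 h1 h2 CG f) (hCG : 0 < CG)
    (hμ0 : 0 < μ0) (hμ1 : 0 < μ1) (hμ2 : 0 < μ2) (hh0 : 0 < h0) (hh2 : 0 < h2)
    (hc1 : μ1 * c ≤ h1) (hc2 : μ2 * c ≤ h2) (N : ℕ) :
    ∀ a k l : ℕ, 2 * a + k + l < N → c ≤ f 0 (a + 1) k l - f 0 a k l := by
  induction N with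
  | zero => intro a k l h; omega
  | succ N ih =>
    intro a k l hN
    have e1 := hf 0 (a + 1) k l (Or.inl rfl)
    have e2 := hf 0 a k l (Or.inl rfl)
    simp only [nx, Nat.add_sub_cancel] at e1 e2
    have tj := term_bound a hμ0 (c := c)
      (x := min (f 0 a (k + 1) l) (f 0 a k (l + 1)))
      (y := min (f 0 (a - 1) (k + 1) l) (f 0 (a - 1) k (l + 1)))
      (fun h => by
        have i1 := ih (a - 1) (k + 1) l (by omega)
        have i2 := ih (a - 1) k (l + 1) (by omega)
        rw [Nat.sub_add_cancel h] at i1 i2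
        exact min_bound i1 i2)
    have t0 : μ0 * c ≤ μ0 * (min (f 0 a (k + 1) l) (f 0 a k (l + 1)) - f 0 a k l) := by
      refine mul_le_mul_of_nonneg_left ?_ hμ0.le
      have := min_bound (bound_E hf hμ0 hμ1 hμ2 hc1 _ a k l (Nat.lt_succ_self _))
        (bound_L hf hCG hμ0 hμ1 hμ2 hh2 hc2 _ a k l (Nat.lt_succ_self _))
      rwa [min_self] at this
    have tk := term_bound k hμ1 (c := c) (x := f 0 (a + 1) (k - 1) l) (y := f 0 a (k - 1) l)
      (fun h => ih _ _ _ (by omega))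
    have tl := term_bound (min l CG) hμ2 (c := c) (x := f 0 (a + 1) k (l - 1))
      (y := f 0 a k (l - 1)) (fun h => ih _ _ _ (by omega))
    have hR : 0 < (a : ℝ) * μ0 + (k : ℝ) * μ1 + ((min l CG : ℕ) : ℝ) * μ2 + μ0 := by positivity
    refine le_of_mul_le_mul_left ?_ hR
    push_cast at e1 e2 tl ⊢
    linarith

/-- An extra waiting job. -/
lemma bound_G (hf : IsRec μ0 μ1 μ2 h0 h1 h2 CG f) (hCG : 0 < CG)
    (hμ0 : 0 < μ0) (hμ1 : 0 < μ1) (hμ2 : 0 < μ2) (hh0 : 0 < h0) (hh2 : 0 < h2)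
    (hc1 : μ1 * c ≤ h1) (hc2 : μ2 * c ≤ h2) (N : ℕ) :
    ∀ i a k l : ℕ, 1 ≤ a + k + l → 2 * (i + a) + k + l < N →
      c ≤ f (i + 1) a k l - f i a k l := by
  induction N with
  | zero => intro i a k l _ h; omega
  | succ N ih =>
    intro i a k l hs hN
    have e1 := hf (i + 1) a k l (Or.inr hs)
    have e2 := hf i a k l (Or.inr hs)
    have tj := term_bound a hμ0 (c := c)
      (x := min (f (i + 1) (a - 1) (k + 1) l) (f (i + 1) (a - 1) k (l + 1)))
      (y := min (f i (a - 1) (k + 1) l) (f i (a - 1) k (l + 1)))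
      (fun h => min_bound (ih _ _ _ _ (by omega) (by omega)) (ih _ _ _ _ (by omega) (by omega)))
    have key : ∀ k' l' : ℕ, k' + l' < k + l →
        c ≤ nx f (i + 1) a k' l' - nx f i a k' l' := by
      intro k' l' hlt
      cases i with
      | zero => exact bound_H hf hCG hμ0 hμ1 hμ2 hh0 hh2 hc1 hc2 _ a k' l' (Nat.lt_succ_self _)
      | succ i => exact ih i (a + 1) k' l' (by omega) (by omega)
    have tk := term_bound k hμ1 (c := c) (fun h => key (k - 1) l (by omega))
    have tl := term_bound (min l CG) hμ2 (c := c) (fun h => key k (l - 1) (by omega))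
    refine le_of_mul_le_mul_left ?_ (dRate_pos hCG hμ0 hμ1 hμ2 a k l hs)
    push_cast at e1 e2 tl ⊢
    linarith

/-- Completion of a phase 1 job is worth at least `c`. -/
lemma bound_F (hf : IsRec μ0 μ1 μ2 h0 h1 h2 CG f) (hCG : 0 < CG)
    (hμ0 : 0 < μ0) (hμ1 : 0 < μ1) (hμ2 : 0 < μ2) (hh0 : 0 < h0) (hh2 : 0 < h2)
    (hc1 : μ1 * c ≤ h1) (hc2 : μ2 * c ≤ h2) (N : ℕ) :
    ∀ i a k l : ℕ, 2 * (i + a) + k + l < N →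
      c ≤ f i a (k + 1) l - nx f i a k l := by
  induction N with
  | zero => intro i a k l h; omega
  | succ N ih =>
    intro i a k l hN
    cases i with
    | zero => exact bound_E hf hμ0 hμ1 hμ2 hc1 _ a k l (Nat.lt_succ_self _)
    | succ i =>
      have e1 := hf (i + 1) a (k + 1) l (Or.inr (by omega))
      have e2 := hf i (a + 1) k l (Or.inr (by omega))
      simp only [Nat.add_sub_cancel] at e1 e2
      have tj := term_bound a hμ0 (c := c)
        (x := min (f (i + 1) (a - 1) (k + 1 + 1) l) (f (i + 1) (a - 1) (k + 1) (l + 1)))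
        (y := min (f i a (k + 1) l) (f i a k (l + 1)))
        (fun h => by
          have i1 := ih (i + 1) (a - 1) (k + 1) l (by omega)
          have i2 := ih (i + 1) (a - 1) k (l + 1) (by omega)
          simp only [nx] at i1 i2
          rw [Nat.sub_add_cancel h] at i1 i2
          exact min_bound i1 i2)
      have t0 : μ0 * c ≤ μ0 * (f (i + 1) a (k + 1) l
          - min (f i a (k + 1) l) (f i a k (l + 1))) := by
        refine mul_le_mul_of_nonneg_left ?_ hμ0.le
        have := bound_G hf hCG hμ0 hμ1 hμ2 hh0 hh2 hc1 hc2 _ i a (k + 1) l (by omega)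
          (Nat.lt_succ_self _)
        linarith [min_le_left (f i a (k + 1) l) (f i a k (l + 1))]
      have tk := term_bound k hμ1 (c := c) (x := f i (a + 1) k l) (y := nx f i (a + 1) (k - 1) l)
        (fun h => by
          have := ih i (a + 1) (k - 1) l (by omega)
          rwa [Nat.sub_add_cancel h] at this)
      have tl := term_bound (min l CG) hμ2 (c := c) (x := f i (a + 1) (k + 1) (l - 1))
        (y := nx f i (a + 1) k (l - 1)) (fun h => ih _ _ _ _ (by omega))
      have hR : 0 < (a : ℝ) * μ0 + (k : ℝ) * μ1 + ((min l CG : ℕ) : ℝ) * μ2 + μ0 + μ1 := by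
        positivity
      refine le_of_mul_le_mul_left ?_ hR
      simp only [nx] at e1 ⊢
      push_cast at e1 e2 tl ⊢
      linarith

/-- The main comparison. -/
lemma bound_D (hf : IsRec μ0 μ1 μ2 h0 h1 h2 CG f) (hCG : 0 < CG)
    (hμ0 : 0 < μ0) (hμ1 : 0 < μ1) (hμ2 : 0 < μ2) (hh0 : 0 < h0) (hh2 : 0 < h2)
    (hμ : μ1 ≤ μ2) (hc1 : μ1 * c ≤ h1) (hc2 : μ2 * c = h2) (N : ℕ) :
    ∀ i a k l : ℕ, l < CG → 2 * (i + a) + k + l < N →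
      0 ≤ f i a (k + 1) l - f i a k (l + 1) ∧
      (μ1 * c < h1 → 0 < f i a (k + 1) l - f i a k (l + 1)) := by
  induction N with
  | zero => intro i a k l _ h; omega
  | succ N ih =>
    intro i a k l hl hN
    have e1 := hf i a (k + 1) l (Or.inr (by omega))
    have e2 := hf i a k (l + 1) (Or.inr (by omega))
    simp only [Nat.add_sub_cancel] at e1 e2
    have tj := term_bound a hμ0 (c := 0)
      (x := min (f i (a - 1) (k + 1 + 1) l) (f i (a - 1) (k + 1) (l + 1)))
      (y := min (f i (a - 1) (k + 1) (l + 1)) (f i (a - 1) k (l + 1 + 1)))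
      (fun h => by
        have i1 := (ih i (a - 1) (k + 1) l hl (by omega)).1
        have i2 := min_le_left (f i (a - 1) (k + 1) (l + 1)) (f i (a - 1) k (l + 1 + 1))
        rw [min_eq_right (by linarith)]
        linarith)
    have key : ∀ k' l' : ℕ, l' < CG → k' + l' < k + l →
        0 ≤ nx f i a (k' + 1) l' - nx f i a k' (l' + 1) := by
      intro k' l' hl' hlt
      cases i with
      | zero => exact (ih 0 a k' l' hl' (by omega)).1
      | succ i => exact (ih i (a + 1) k' l' hl' (by omega)).1
    have tk := term_bound k hμ1 (c := 0) (x := nx f i a k l) (y := nx f i a (k - 1) (l + 1))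
      (fun h => by
        have := key (k - 1) l hl (by omega)
        rwa [Nat.sub_add_cancel h] at this)
    have tl := term_bound l hμ2 (c := 0) (x := nx f i a (k + 1) (l - 1)) (y := nx f i a k l)
      (fun h => by
        have := key k (l - 1) (by omega) (by omega)
        rwa [Nat.sub_add_cancel h] at this)
    have tF := mul_le_mul_of_nonneg_left
      (bound_F hf hCG hμ0 hμ1 hμ2 hh0 hh2 hc1 hc2.le _ i a k l (Nat.lt_succ_self _))
      (sub_nonneg.2 hμ)
    have m1 : min (l + 1) CG = l + 1 := by omega
    have m2 : min l CG = l := by omega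
    rw [m1] at e2
    rw [m2] at e1
    have hR : 0 < (a : ℝ) * μ0 + (k : ℝ) * μ1 + (l : ℝ) * μ2 + μ2 := by positivity
    have main : h1 - μ1 * c ≤ ((a : ℝ) * μ0 + (k : ℝ) * μ1 + (l : ℝ) * μ2 + μ2)
        * (f i a (k + 1) l - f i a k (l + 1)) := by
      push_cast at e1 e2
      linarith
    constructor
    · exact nonneg_of_mul_nonneg_right (by linarith) hR
    · intro hlt
      exact pos_of_mul_pos_right (by linarith) hR.le
end bounds

theorem stmt2 (Cp CG : ℕ) (μ0 μ1 μ2 h0 h1 h2 : ℝ)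
    (hCp : 0 < Cp) (hCG : 0 < CG) (hCpCG : CG < Cp)
    (hμ0 : 0 < μ0) (hμ1 : 0 < μ1) (hμ2 : 0 < μ2)
    (hh0 : 0 < h0) (hh1 : 0 < h1) (hh2 : 0 < h2)
    (hq : h2 / μ2 ≤ h1 / μ1) (hμ : μ1 ≤ μ2) :
    ∀ i j k l : ℕ, memX Cp i j k l → 1 ≤ j → l < CG →
      0 ≤ v μ0 μ1 μ2 h0 h1 h2 CG i (j - 1) (k + 1) l - v μ0 μ1 μ2 h0 h1 h2 CG i (j - 1) k (l + 1) ∧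
      (h2 / μ2 < h1 / μ1 → 0 < v μ0 μ1 μ2 h0 h1 h2 CG i (j - 1) (k + 1) l - v μ0 μ1 μ2 h0 h1 h2 CG i (j - 1) k (l + 1)) := by
  intro i j k l _ _ hl
  have hc2 : μ2 * (h2 / μ2) = h2 := mul_div_cancel₀ _ hμ2.ne'
  have hc1 : μ1 * (h2 / μ2) ≤ h1 := by
    rw [mul_comm]
    exact (le_div_iff₀ hμ1).1 hq
  have h := bound_D (v_isRec h0 h1 h2 hCG hμ0 hμ1 hμ2) hCG hμ0 hμ1 hμ2 hh0 hh2 hμ hc1 hc2 _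
    i (j - 1) k l hl (Nat.lt_succ_self _)
  refine ⟨h.1, fun hlt => h.2 ?_⟩
  rw [mul_comm]
  exact (lt_div_iff₀ hμ1).1 hlt
end

section
/- Suppose CG ≥ Cp, h1/μ1 ≥ h2/μ2 and μ1 ≤ μ2. Then for every decision state (i,j,k,l) ∈ X_D one has D(i,j,k,l) = v(i,j-1,k+1,l) − v(i,j-1,k,l+1) ≥ 0. -/
/-- value after completion of one job, with remaining servers `j,k,l` -/
noncomputable def nxt (V : ℕ → ℕ → ℕ → ℕ → ℝ) : ℕ → ℕ → ℕ → ℕ → ℝ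
  | 0, j, k, l => V 0 j k l
  | i + 1, j, k, l => V i (j + 1) k l

theorem nxt_zero (V : ℕ → ℕ → ℕ → ℕ → ℝ) (j k l : ℕ) : nxt V 0 j k l = V 0 j k l := rfl

theorem nxt_succ (V : ℕ → ℕ → ℕ → ℕ → ℝ) (i j k l : ℕ) :
    nxt V (i + 1) j k l = V i (j + 1) k l := rfl

theorem v_rec (CG : ℕ) (μ0 μ1 μ2 h0 h1 h2 : ℝ)
    (hμ0 : 0 < μ0) (hμ1 : 0 < μ1) (hμ2 : 0 < μ2)
    (i j k l : ℕ) (hl : j + k + l ≤ CG) (hp : i = 0 ∨ 1 ≤ j + k + l) :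
    ((j : ℝ) * μ0 + k * μ1 + l * μ2) * v μ0 μ1 μ2 h0 h1 h2 CG i j k l
      = ((i : ℝ) + j) * h0 + k * h1 + l * h2
        + j * μ0 * min (v μ0 μ1 μ2 h0 h1 h2 CG i (j - 1) (k + 1) l)
            (v μ0 μ1 μ2 h0 h1 h2 CG i (j - 1) k (l + 1))
        + k * μ1 * nxt (v μ0 μ1 μ2 h0 h1 h2 CG) i j (k - 1) l
        + l * μ2 * nxt (v μ0 μ1 μ2 h0 h1 h2 CG) i j k (l - 1) := by
  by_cases hz : j + k + l = 0
  · obtain ⟨rfl, rfl, rfl⟩ : j = 0 ∧ k = 0 ∧ l = 0 := by omega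
    have : i = 0 := by omega
    subst this
    simp
  have hmin : min l CG = l := by omega
  have hd : (j : ℝ) * μ0 + k * μ1 + l * μ2 ≠ 0 := by
    have hj : 0 ≤ (j : ℝ) * μ0 := by positivity
    have hk : 0 ≤ (k : ℝ) * μ1 := by positivity
    have hl : 0 ≤ (l : ℝ) * μ2 := by positivity
    intro h0
    have e1 : (j : ℝ) * μ0 = 0 := by linarith
    have e2 : (k : ℝ) * μ1 = 0 := by linarith
    have e3 : (l : ℝ) * μ2 = 0 := by linarith
    simp [hμ0.ne', hμ1.ne', hμ2.ne'] at e1 e2 e3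
    omega
  have g1 : ∀ (n : ℕ) (a b : ℝ), (if _ : 1 ≤ n then (n : ℝ) * a * b else 0) = n * a * b := by
    intro n a b
    rcases n with _ | n <;> simp
  cases i with
  | zero =>
    rw [v]
    · rw [dRate, hmin, g1, g1, g1, mul_div_cancel₀ _ hd]
      simp only [nxt]
      push_cast
      ring
    · intro a b c; omega
  | succ i =>
    rw [v, dRate, hmin, g1, g1, g1, mul_div_cancel₀ _ hd]
    simp only [nxt]
    push_cast
    ring

theorem coef_le (n : ℕ) (a x y : ℝ) (ha : 0 < a) (h : 1 ≤ n → x ≤ y) :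
    (n : ℝ) * a * x ≤ n * a * y := by
  rcases n with _ | n
  · simp
  · exact mul_le_mul_of_nonneg_left (h (by omega)) (by positivity)

theorem main_ind (CG : ℕ) (μ0 μ1 μ2 h0 h1 h2 q : ℝ)
    (hμ0 : 0 < μ0) (hμ1 : 0 < μ1) (hμ2 : 0 < μ2) (hh0 : 0 < h0)
    (hq : μ2 * q = h2) (hq1 : μ1 * q ≤ h1) (hμ : μ1 ≤ μ2)
    (V : ℕ → ℕ → ℕ → ℕ → ℝ)
    (hV : ∀ i j k l : ℕ, j + k + l ≤ CG → (i = 0 ∨ 1 ≤ j + k + l) →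
      ((j : ℝ) * μ0 + k * μ1 + l * μ2) * V i j k l
      = ((i : ℝ) + j) * h0 + k * h1 + l * h2
        + j * μ0 * min (V i (j - 1) (k + 1) l) (V i (j - 1) k (l + 1))
        + k * μ1 * nxt V i j (k - 1) l
        + l * μ2 * nxt V i j k (l - 1)) (n : ℕ) :
    ∀ i j k l : ℕ, 2 * (i + j) + k + l = n → j + k + l + 1 ≤ CG →
      nxt V i j k l + q ≤ V i j k (l + 1) ∧ V i j k (l + 1) ≤ V i j (k + 1) l ∧
      V i j k (l + 1) ≤ V i (j + 1) k l := by
  induction n using Nat.strong_induction_on with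
  | _ n ih =>
  intro i j k l hn hC
  have IH : ∀ i' j' k' l' : ℕ, 2 * (i' + j') + k' + l' < n → j' + k' + l' + 1 ≤ CG →
      nxt V i' j' k' l' + q ≤ V i' j' k' (l' + 1) ∧ V i' j' k' (l' + 1) ≤ V i' j' (k' + 1) l' ∧
      V i' j' k' (l' + 1) ≤ V i' (j' + 1) k' l' := fun i' j' k' l' h h' => ih _ h i' j' k' l' rfl h'
  have c0 : 0 ≤ (j : ℝ) * μ0 + k * μ1 + l * μ2 := by positivity
  have hb := hV i j k (l + 1) (by omega) (by omega)
  have ha := hV i j (k + 1) l (by omega) (by omega)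
  have hf := hV i (j + 1) k l (by omega) (by omega)
  simp only [Nat.add_sub_cancel] at hb ha hf
  push_cast at hb ha hf
  have E : nxt V i j k l + q ≤ V i j k (l + 1) := by
    have t0 : (j : ℝ) * μ0 * (min (nxt V i (j - 1) (k + 1) l) (nxt V i (j - 1) k (l + 1)) + q) ≤
        j * μ0 * min (V i (j - 1) (k + 1) (l + 1)) (V i (j - 1) k (l + 1 + 1)) := by
      apply coef_le _ _ _ _ hμ0
      intro hj
      have e1 := (IH i (j - 1) (k + 1) l (by omega) (by omega)).1
      have e2 := (IH i (j - 1) k (l + 1) (by omega) (by omega)).1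
      rw [← min_add_add_right]
      exact min_le_min e1 e2
    suffices h : 0 ≤ ((j : ℝ) * μ0 + k * μ1 + l * μ2 + μ2) * (V i j k (l + 1) - (nxt V i j k l + q)) by
      have := nonneg_of_mul_nonneg_right h (by linarith)
      linarith
    cases i with
    | zero =>
      have hs := hV 0 j k l (by omega) (by omega)
      simp only [nxt_zero] at hs hb t0 ⊢
      have t1 : (k : ℝ) * μ1 * (V 0 j (k - 1) l + q) ≤ k * μ1 * V 0 j (k - 1) (l + 1) :=
        coef_le _ _ _ _ hμ1 fun hk => (IH 0 j (k - 1) l (by omega) (by omega)).1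
      have t2 : (l : ℝ) * μ2 * (V 0 j k (l - 1) + q) ≤ l * μ2 * V 0 j k l :=
        coef_le _ _ _ _ hμ2 fun hk => by
          have := (IH 0 j k (l - 1) (by omega) (by omega)).1
          rwa [Nat.sub_add_cancel hk] at this
      linarith
    | succ i =>
      have hs := hV i (j + 1) k l (by omega) (by omega)
      simp only [nxt_succ, Nat.add_sub_cancel] at hs hb t0 ⊢
      push_cast at hs hb t0 ⊢
      have t1 : (k : ℝ) * μ1 * (nxt V i (j + 1) (k - 1) l + q) ≤ k * μ1 * V i (j + 1) (k - 1) (l + 1) :=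
        coef_le _ _ _ _ hμ1 fun hk => (IH i (j + 1) (k - 1) l (by omega) (by omega)).1
      have t2 : (l : ℝ) * μ2 * (nxt V i (j + 1) k (l - 1) + q) ≤ l * μ2 * V i (j + 1) k l :=
        coef_le _ _ _ _ hμ2 fun hk => by
          have := (IH i (j + 1) k (l - 1) (by omega) (by omega)).1
          rwa [Nat.sub_add_cancel hk] at this
      have t3 : (j : ℝ) * μ0 * min (V i j (k + 1) l) (V i j k (l + 1)) ≤
          j * μ0 * min (V i (j - 1 + 1) (k + 1) l) (V i (j - 1 + 1) k (l + 1)) :=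
        coef_le _ _ _ _ hμ0 fun hk => by rw [Nat.sub_add_cancel hk]
      have t4 : μ0 * min (V i j (k + 1) l) (V i j k (l + 1)) ≤ μ0 * V i (j + 1) k l :=
        mul_le_mul_of_nonneg_left
          ((min_le_right _ _).trans (IH i j k l (by omega) (by omega)).2.2) hμ0.le
      linarith
  have D : V i j k (l + 1) ≤ V i j (k + 1) l := by
    suffices h : 0 ≤ ((j : ℝ) * μ0 + k * μ1 + l * μ2 + μ1) * (V i j (k + 1) l - V i j k (l + 1)) by
      have := nonneg_of_mul_nonneg_right h (by linarith)
      linarith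
    have t0 : (j : ℝ) * μ0 * min (V i (j - 1) (k + 1) (l + 1)) (V i (j - 1) k (l + 1 + 1)) ≤
        j * μ0 * min (V i (j - 1) (k + 1 + 1) l) (V i (j - 1) (k + 1) (l + 1)) :=
      coef_le _ _ _ _ hμ0 fun hj => min_le_min
        (IH i (j - 1) (k + 1) l (by omega) (by omega)).2.1
        (IH i (j - 1) k (l + 1) (by omega) (by omega)).2.1
    have t1 : (k : ℝ) * μ1 * nxt V i j (k - 1) (l + 1) ≤ k * μ1 * nxt V i j k l :=
      coef_le _ _ _ _ hμ1 fun hk => by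
        cases i with
        | zero =>
          have := (IH 0 j (k - 1) l (by omega) (by omega)).2.1
          rwa [Nat.sub_add_cancel hk] at this
        | succ i =>
          have := (IH i (j + 1) (k - 1) l (by omega) (by omega)).2.1
          rwa [Nat.sub_add_cancel hk] at this
    have t2 : (l : ℝ) * μ2 * nxt V i j k l ≤ l * μ2 * nxt V i j (k + 1) (l - 1) :=
      coef_le _ _ _ _ hμ2 fun hk => by
        cases i with
        | zero =>
          have := (IH 0 j k (l - 1) (by omega) (by omega)).2.1
          rwa [Nat.sub_add_cancel hk] at this
        | succ i =>
          have := (IH i (j + 1) k (l - 1) (by omega) (by omega)).2.1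
          rwa [Nat.sub_add_cancel hk] at this
    have t3 : (μ2 - μ1) * (nxt V i j k l + q) ≤ (μ2 - μ1) * V i j k (l + 1) :=
      mul_le_mul_of_nonneg_left E (by linarith)
    linarith
  refine ⟨E, D, ?_⟩
  suffices h : 0 ≤ ((j : ℝ) * μ0 + k * μ1 + l * μ2 + μ0) * (V i (j + 1) k l - V i j k (l + 1)) by
    have := nonneg_of_mul_nonneg_right h (by linarith)
    linarith
  rw [min_eq_right D] at hf
  have t0 : (j : ℝ) * μ0 * min (V i (j - 1) (k + 1) (l + 1)) (V i (j - 1) k (l + 1 + 1)) ≤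
      j * μ0 * V i j k (l + 1) :=
    coef_le _ _ _ _ hμ0 fun hj => by
      have := (IH i (j - 1) k (l + 1) (by omega) (by omega)).2.2
      rw [Nat.sub_add_cancel hj] at this
      exact (min_le_right _ _).trans this
  have t1 : (k : ℝ) * μ1 * nxt V i j (k - 1) (l + 1) ≤ k * μ1 * nxt V i (j + 1) (k - 1) l :=
    coef_le _ _ _ _ hμ1 fun hk => by
      cases i with
      | zero => exact (IH 0 j (k - 1) l (by omega) (by omega)).2.2
      | succ i => exact (IH i (j + 1) (k - 1) l (by omega) (by omega)).2.2
  have t2 : (l : ℝ) * μ2 * nxt V i j k l ≤ l * μ2 * nxt V i (j + 1) k (l - 1) :=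
    coef_le _ _ _ _ hμ2 fun hk => by
      cases i with
      | zero =>
        have := (IH 0 j k (l - 1) (by omega) (by omega)).2.2
        rwa [Nat.sub_add_cancel hk] at this
      | succ i =>
        have := (IH i (j + 1) k (l - 1) (by omega) (by omega)).2.2
        rwa [Nat.sub_add_cancel hk] at this
  have t3 : μ2 * (nxt V i j k l + q) ≤ μ2 * V i j k (l + 1) :=
    mul_le_mul_of_nonneg_left E hμ2.le
  linarith

theorem stmt6 (Cp CG : ℕ) (μ0 μ1 μ2 h0 h1 h2 : ℝ)
    (hCp : 0 < Cp) (hCG : 0 < CG) (hCpCG : Cp ≤ CG)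
    (hμ0 : 0 < μ0) (hμ1 : 0 < μ1) (hμ2 : 0 < μ2)
    (hh0 : 0 < h0) (hh1 : 0 < h1) (hh2 : 0 < h2)
    (hq : h2 / μ2 ≤ h1 / μ1) (hμ : μ1 ≤ μ2) :
    ∀ i j k l : ℕ, memX Cp i j k l → 1 ≤ j →
      0 ≤ v μ0 μ1 μ2 h0 h1 h2 CG i (j - 1) (k + 1) l - v μ0 μ1 μ2 h0 h1 h2 CG i (j - 1) k (l + 1) := by
  intro i j k l hX hj
  have hle : j + k + l ≤ CG := by
    rcases hX with h | h <;> omega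
  have h := main_ind CG μ0 μ1 μ2 h0 h1 h2 (h2 / μ2) hμ0 hμ1 hμ2 hh0
    (mul_div_cancel₀ _ hμ2.ne')
    (by rw [le_div_iff₀ hμ1] at hq; linarith) hμ
    (v μ0 μ1 μ2 h0 h1 h2 CG)
    (fun i j k l => v_rec CG μ0 μ1 μ2 h0 h1 h2 hμ0 hμ1 hμ2 i j k l) _
    i (j - 1) k l rfl (by omega)
  linarith [h.2.1]
end
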